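/- arXiv:2110.08385 — 4 statements merged into one kernel-verified Lean document; each statement's English description precedes it below -/
import Mathlib

section
/- Let G = (V, W) be a signed graph on n nodes. Suppose that for each edge ii' with W_{ii'} < 0 there exists a set of m disjoint two-edge ii'-paths i–i_1–i', ..., i–i_m–i' all of whose edges have positive weights, satisfying −W_{ii'} ≤ Σ_{l=1}^{m} W_{i i_l} W_{i' i_l} / (W_{i i_l} + W_{i' i_l}) (i.e. −W_{ii'} is at most the sum over the paths of half the harmonic mean of the two weights on each path), and suppose that these two-edge paths are edge-disjoint across all negative edges. Then the Laplacian L(G) is positive semidefinite. -/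
open Finset in
/-- The quadratic form of the Laplacian of a symmetric weight matrix, as a sum over ordered pairs. -/
theorem two_mul_dotProduct_laplacian_mulVec {ι : Type*} [Fintype ι] [DecidableEq ι]
    {W : Matrix ι ι ℝ} (hW : W.IsSymm) (x : ι → ℝ) :
    2 * (x ⬝ᵥ ((Matrix.diagonal (fun i => ∑ j, W i j) - W).mulVec x)) =
      ∑ i, ∑ j, W i j * (x i - x j) ^ 2 := by
  have hexp : x ⬝ᵥ ((Matrix.diagonal (fun i => ∑ j, W i j) - W).mulVec x) =
      ∑ i, ∑ j, W i j * (x i * (x i - x j)) := by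
    rw [Matrix.sub_mulVec, dotProduct]
    refine sum_congr rfl fun i _ => ?_
    rw [Pi.sub_apply, Matrix.mulVec_diagonal, Matrix.mulVec, dotProduct, sum_mul,
      ← sum_sub_distrib, mul_sum]
    exact sum_congr rfl fun j _ => by ring
  have hswap : ∑ i, ∑ j, W i j * (x i * (x i - x j)) =
      ∑ i, ∑ j, W i j * (x j * (x j - x i)) := by
    rw [sum_comm]
    exact sum_congr rfl fun i _ => sum_congr rfl fun j _ => by rw [hW.apply i j]
  rw [two_mul, hexp]
  nth_rewrite 2 [hswap]
  simp only [← sum_add_distrib]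
  exact sum_congr rfl fun i _ => sum_congr rfl fun j _ => by ring

/-- Two springs in series: half the harmonic mean of the weights is the effective weight. -/
theorem mul_div_add_mul_sq_sub_le {a b : ℝ} (ha : 0 < a) (hb : 0 < b) (x y z : ℝ) :
    a * b / (a + b) * (x - y) ^ 2 ≤ a * (x - z) ^ 2 + b * (y - z) ^ 2 := by
  rw [div_mul_eq_mul_div, div_le_iff₀ (by positivity)]
  nlinarith [sq_nonneg (a * (x - z) + b * (y - z))]

open Finset in
/-- If at most one index over two families satisfies its predicate, the sum of the corresponding
indicators is at most the common value. -/
theorem sum_ite_add_sum_ite_le {ι : Type*} [Fintype ι] (p q : ι → Prop) [DecidablePred p]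
    [DecidablePred q] {c M : ℝ} (hM : 0 ≤ M) (hp : ∀ j, p j → c ≤ M) (hq : ∀ j, q j → c ≤ M)
    (hpp : ∀ j k, p j → p k → j = k) (hqq : ∀ j k, q j → q k → j = k)
    (hpq : ∀ j k, p j → ¬ q k) :
    (∑ j, if p j then c else 0) + (∑ j, if q j then c else 0) ≤ M := by
  have single (r : ι → Prop) [DecidablePred r] (hr : ∀ j k, r j → r k → j = k) (j : ι)
      (hj : r j) : (∑ k, if r k then c else 0) = c := by
    rw [sum_eq_single j (fun k _ hk => if_neg fun h => hk (hr k j h hj)) (by simp), if_pos hj]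
  have none (r : ι → Prop) [DecidablePred r] (hr : ∀ j, ¬ r j) :
      (∑ k, if r k then c else 0) = 0 :=
    sum_eq_zero fun k _ => if_neg (hr k)
  by_cases h : ∃ j, p j
  · obtain ⟨j, hj⟩ := h
    rw [single p hpp j hj, none q fun k => hpq j k hj, add_zero]
    exact hp j hj
  · rw [none p (not_exists.mp h), zero_add]
    by_cases h' : ∃ j, q j
    · obtain ⟨j, hj⟩ := h'
      rw [single q hqq j hj]
      exact hq j hj
    · rwa [none q (not_exists.mp h')]

/-- If in a signed graph every negative edge `ii'` can be compensated by a
collection of pairwise-disjoint two-edge `ii'`-paths of positive weights (intermediate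
nodes `P i i'`), with
`-W_{ii'} ≤ ∑_{l ∈ P i i'} W_{i l} W_{i' l} / (W_{i l} + W_{i' l})`,
and the path edges are disjoint across all negative edges, then the Laplacian
`Diag(W e) - W` is positive semidefinite. -/
theorem stmt_1 (n : ℕ) (W : Matrix (Fin n) (Fin n) ℝ)
    (hWsym : W.IsSymm) (hWdiag : ∀ i, W i i = 0)
    (P : Fin n → Fin n → Finset (Fin n))
    (hPsym : ∀ i i', P i i' = P i' i)
    -- intermediate nodes are distinct from the endpoints
    (hPne : ∀ i i', W i i' < 0 → ∀ l ∈ P i i', l ≠ i ∧ l ≠ i')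
    -- the two edges of each path have positive weights
    (hPpos : ∀ i i', W i i' < 0 → ∀ l ∈ P i i', 0 < W i l ∧ 0 < W i' l)
    -- the compensation inequality (half the harmonic mean of the two path weights)
    (hbound : ∀ i i', W i i' < 0 →
      -W i i' ≤ ∑ l ∈ P i i', W i l * W i' l / (W i l + W i' l))
    -- the two-edge paths are edge-disjoint across all negative edges
    (hdisj : ∀ i i' j j' : Fin n, W i i' < 0 → W j j' < 0 → s(i, i') ≠ s(j, j') →
      Disjoint
        ((P i i').image (fun l => s(i, l)) ∪ (P i i').image (fun l => s(i', l)))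
        ((P j j').image (fun l => s(j, l)) ∪ (P j j').image (fun l => s(j', l)))) :
    (Matrix.diagonal (fun i => ∑ j, W i j) - W).PosSemidef := by
  have symm (i j : Fin n) : W i j = W j i := hWsym.apply j i
  refine Matrix.PosSemidef.of_dotProduct_mulVec_nonneg ?_ fun x => ?_
  · rw [Matrix.IsHermitian, Matrix.conjTranspose_eq_transpose_of_trivial, Matrix.transpose_sub,
      Matrix.diagonal_transpose, hWsym.eq]
  rw [star_trivial]
  suffices 0 ≤ ∑ i, ∑ j, W i j * (x i - x j) ^ 2 by
    rw [← two_mul_dotProduct_laplacian_mulVec hWsym x] at this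
    linarith
  let T : Fin n → Fin n → Fin n → ℝ := fun i j l =>
    if W i j < 0 ∧ l ∈ P i j then W i l * (x i - x l) ^ 2 else 0
  have hdisj' (i j k m l l' : Fin n) (hij : W i j < 0) (hl : l ∈ P i j) (hkm : W k m < 0)
      (hl' : l' ∈ P k m) (he : s(i, l) = s(k, l')) : s(i, j) = s(k, m) := by
    by_contra hne
    refine Finset.disjoint_left.mp (hdisj i j k m hij hkm hne)
      (Finset.mem_union_left _ (Finset.mem_image_of_mem _ hl)) ?_
    rw [he]
    exact Finset.mem_union_left _ (Finset.mem_image_of_mem _ hl')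
  have hpos (a b : Fin n) :
      ∑ j, T a j b + ∑ j, T b j a ≤ max (W a b) 0 * (x a - x b) ^ 2 := by
    have hba : W b a * (x b - x a) ^ 2 = W a b * (x a - x b) ^ 2 := by rw [symm b a]; ring
    have hle : W a b * (x a - x b) ^ 2 ≤ max (W a b) 0 * (x a - x b) ^ 2 :=
      mul_le_mul_of_nonneg_right (le_max_left _ _) (sq_nonneg _)
    simp only [T, hba]
    refine sum_ite_add_sum_ite_le _ _ (mul_nonneg (le_max_right _ _) (sq_nonneg _))
      (fun _ _ => hle) (fun _ _ => hle) ?_ ?_ ?_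
    · rintro j k ⟨hj, hbj⟩ ⟨hk, hbk⟩
      exact Sym2.congr_right.mp (hdisj' a j a k b b hj hbj hk hbk rfl)
    · rintro j k ⟨hj, hbj⟩ ⟨hk, hbk⟩
      exact Sym2.congr_right.mp (hdisj' b j b k a a hj hbj hk hbk rfl)
    · rintro j k ⟨hj, hbj⟩ ⟨hk, hak⟩
      rcases Sym2.eq_iff.mp (hdisj' a j b k b a hj hbj hk hak Sym2.eq_swap) with h | h
      · exact (hPne a j hj b hbj).1 h.1.symm
      · exact (hPne b k hk a hak).2 h.1
  have hneg (i j : Fin n) :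
      max (-W i j) 0 * (x i - x j) ^ 2 ≤ ∑ l, T i j l + ∑ l, T j i l := by
    by_cases hij : W i j < 0
    · have hji : W j i < 0 := symm i j ▸ hij
      simp only [T, hij, hji, hPsym j i, true_and, Finset.sum_ite_mem, Finset.univ_inter]
      rw [max_eq_left (by linarith), ← Finset.sum_add_distrib]
      refine (mul_le_mul_of_nonneg_right (hbound i j hij) (sq_nonneg _)).trans ?_
      rw [Finset.sum_mul]
      refine Finset.sum_le_sum fun l hl => ?_
      obtain ⟨h₁, h₂⟩ := hPpos i j hij l hl
      exact mul_div_add_mul_sq_sub_le h₁ h₂ _ _ _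
    · have hji : ¬ W j i < 0 := symm i j ▸ hij
      simp only [T, hij, hji, false_and, if_false, Finset.sum_const_zero, add_zero]
      rw [max_eq_right (by linarith), zero_mul]
  have hsum : ∑ i, ∑ j, max (-W i j) 0 * (x i - x j) ^ 2 ≤
      ∑ i, ∑ j, max (W i j) 0 * (x i - x j) ^ 2 := by
    calc _ ≤ ∑ i, ∑ j, (∑ l, T i j l + ∑ l, T j i l) :=
          Finset.sum_le_sum fun i _ => Finset.sum_le_sum fun j _ => hneg i j
      _ = ∑ i, ∑ l, (∑ j, T i j l + ∑ j, T l j i) := by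
          simp only [Finset.sum_add_distrib]
          congr 1
          · exact Finset.sum_congr rfl fun i _ => Finset.sum_comm
          · calc _ = ∑ j, ∑ i, ∑ l, T j i l := Finset.sum_comm
              _ = ∑ j, ∑ l, ∑ i, T j i l := Finset.sum_congr rfl fun j _ => Finset.sum_comm
              _ = _ := Finset.sum_comm
      _ ≤ _ := Finset.sum_le_sum fun i _ => Finset.sum_le_sum fun l _ => hpos i l
  have hsplit : ∑ i, ∑ j, W i j * (x i - x j) ^ 2 =
      ∑ i, ∑ j, max (W i j) 0 * (x i - x j) ^ 2 -
        ∑ i, ∑ j, max (-W i j) 0 * (x i - x j) ^ 2 := by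
    simp only [← Finset.sum_sub_distrib, ← sub_mul, max_zero_sub_eq_self]
  rw [hsplit]
  exact sub_nonneg.mpr hsum
end

section
/- Let W = q qᵀ − Diag(q ∘ q) + N be a symmetric n×n matrix, where q ∈ ℝⁿ is an entrywise positive vector satisfying max_i q_i^{4/3} ≤ ‖q^{∘2/3}‖² / 45, and N is a symmetric n×n matrix with zero diagonal whose rows nⁱ satisfy ‖nⁱ‖ ≤ q_i ‖q^{∘2/3}‖² / (45 ‖q^{∘1/3}‖) for each i ∈ [n]. Set β = (qᵀ q^{∘1/3})^{3/2}. Then the continuous function f : ℝⁿ → ℝⁿ defined by f(x) = (W x)^{∘1/3} (entrywise real cube root) maps the box S = [½ (β q)^{∘1/3}, (3/2) (β q)^{∘1/3}] into itself. -/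
/-- The real cube root, defined for all real arguments. -/
noncomputable def realCbrt (y : ℝ) : ℝ := Real.sign y * |y| ^ ((1 : ℝ) / 3)

lemma le_realCbrt_and_le {c d y : ℝ} (hc : 0 < c) (hd : 0 ≤ d) (h₁ : c ^ 3 ≤ y) (h₂ : y ≤ d ^ 3) :
    c ≤ realCbrt y ∧ realCbrt y ≤ d := by
  have hy : 0 < y := lt_of_lt_of_le (by positivity) h₁
  have key : ∀ t : ℝ, 0 ≤ t → (t ^ 3) ^ ((1 : ℝ) / 3) = t := fun t ht => by
    rw [← Real.rpow_natCast, ← Real.rpow_mul ht]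
    norm_num
  rw [realCbrt, Real.sign_of_pos hy, one_mul, abs_of_pos hy]
  constructor
  · rw [← key c hc.le]
    exact Real.rpow_le_rpow (by positivity) h₁ (by norm_num)
  · rw [← key d hd]
    exact Real.rpow_le_rpow hy.le h₂ (by norm_num)

lemma abs_sum_mul_le_of_abs_le {ι : Type*} [Fintype ι] (u x a : ι → ℝ) {r : ℝ} (hr : 0 ≤ r)
    (hx : ∀ j, |x j| ≤ r * a j) :
    |∑ j, u j * x j| ≤ √(∑ j, u j ^ 2) * (r * √(∑ j, a j ^ 2)) := by
  have h : √(∑ j, x j ^ 2) ≤ r * √(∑ j, a j ^ 2) := by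
    rw [← Real.sqrt_sq hr, ← Real.sqrt_mul (sq_nonneg r), Finset.mul_sum]
    refine Real.sqrt_le_sqrt (Finset.sum_le_sum fun j _ => ?_)
    rw [← mul_pow]
    exact sq_le_sq' (abs_le.1 (hx j)).1 (abs_le.1 (hx j)).2
  calc |∑ j, u j * x j| ≤ √(∑ j, u j ^ 2) * √(∑ j, x j ^ 2) := by
        rw [← Real.sqrt_mul (Finset.sum_nonneg fun j _ => sq_nonneg _)]
        exact Real.abs_le_sqrt (Finset.sum_mul_sq_le_sq_mul_sq _ _ _)
    _ ≤ _ := mul_le_mul_of_nonneg_left h (Real.sqrt_nonneg _)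

/-- The cubes of the box bounds control `q (qᵀ x) - q ∘ q ∘ x + N x`, where `q = a ^ 3`. -/
lemma cube_bounds_of_mem_box {ι : Type*} [Fintype ι] (a x : ι → ℝ) (ha : ∀ i, 0 < a i)
    {b : ℝ} (hb : 0 < b) (hbS : b ^ 2 = ∑ j, a j ^ 4) (i : ι) (hmax : a i ^ 4 ≤ b ^ 2 / 45)
    (u : ι → ℝ) (hu : √(∑ j, u j ^ 2) ≤ a i ^ 3 * b ^ 2 / (45 * √(∑ j, a j ^ 2)))
    (hx : ∀ j, 1 / 2 * (b * a j) ≤ x j ∧ x j ≤ 3 / 2 * (b * a j)) :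
    (1 / 2 * (b * a i)) ^ 3 ≤
        a i ^ 3 * ∑ j, a j ^ 3 * x j - a i ^ 3 * a i ^ 3 * x i + ∑ j, u j * x j ∧
      a i ^ 3 * ∑ j, a j ^ 3 * x j - a i ^ 3 * a i ^ 3 * x i + ∑ j, u j * x j ≤
        (3 / 2 * (b * a i)) ^ 3 := by
  have hxpos : ∀ j, 0 ≤ x j := fun j =>
    le_trans (by have := ha j; positivity) (hx j).1
  have hai := ha i
  have hlow : 1 / 2 * b ^ 3 ≤ ∑ j, a j ^ 3 * x j := by
    have : 1 / 2 * b ^ 3 = ∑ j, a j ^ 3 * (1 / 2 * (b * a j)) := by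
      rw [show 1 / 2 * b ^ 3 = 1 / 2 * b * b ^ 2 by ring, hbS, Finset.mul_sum]
      exact Finset.sum_congr rfl fun j _ => by ring
    rw [this]
    exact Finset.sum_le_sum fun j _ =>
      mul_le_mul_of_nonneg_left (hx j).1 (pow_nonneg (ha j).le 3)
  have hupp : ∑ j, a j ^ 3 * x j ≤ 3 / 2 * b ^ 3 := by
    have : 3 / 2 * b ^ 3 = ∑ j, a j ^ 3 * (3 / 2 * (b * a j)) := by
      rw [show 3 / 2 * b ^ 3 = 3 / 2 * b * b ^ 2 by ring, hbS, Finset.mul_sum]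
      exact Finset.sum_congr rfl fun j _ => by ring
    rw [this]
    exact Finset.sum_le_sum fun j _ =>
      mul_le_mul_of_nonneg_left (hx j).2 (pow_nonneg (ha j).le 3)
  have hdiag : a i ^ 3 * a i ^ 3 * x i ≤ 1 / 30 * (a i ^ 3 * b ^ 3) :=
    calc a i ^ 3 * a i ^ 3 * x i ≤ a i ^ 3 * a i ^ 3 * (3 / 2 * (b * a i)) :=
          mul_le_mul_of_nonneg_left (hx i).2 (by positivity)
      _ = 3 / 2 * (a i ^ 3 * b) * a i ^ 4 := by ring
      _ ≤ 3 / 2 * (a i ^ 3 * b) * (b ^ 2 / 45) :=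
          mul_le_mul_of_nonneg_left hmax (by positivity)
      _ = _ := by ring
  have hdiag₀ : 0 ≤ a i ^ 3 * a i ^ 3 * x i := mul_nonneg (by positivity) (hxpos i)
  have hT : 0 < √(∑ j, a j ^ 2) :=
    Real.sqrt_pos.2 (Finset.sum_pos (fun j _ => pow_pos (ha j) 2) ⟨i, Finset.mem_univ i⟩)
  have hrow : |∑ j, u j * x j| ≤ 1 / 30 * (a i ^ 3 * b ^ 3) :=
    calc |∑ j, u j * x j| ≤ √(∑ j, u j ^ 2) * (3 / 2 * b * √(∑ j, a j ^ 2)) :=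
          abs_sum_mul_le_of_abs_le u x a (by positivity) fun j => by
            rw [abs_of_nonneg (hxpos j), mul_assoc]
            exact (hx j).2
      _ ≤ a i ^ 3 * b ^ 2 / (45 * √(∑ j, a j ^ 2)) * (3 / 2 * b * √(∑ j, a j ^ 2)) :=
          mul_le_mul_of_nonneg_right hu (by positivity)
      _ = _ := by
          field_simp
          norm_num
  obtain ⟨hrow₁, hrow₂⟩ := abs_le.1 hrow
  have h₁ := mul_le_mul_of_nonneg_left hlow (pow_pos hai 3).le
  have h₂ := mul_le_mul_of_nonneg_left hupp (pow_pos hai 3).le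
  have hpos : 0 < a i ^ 3 * b ^ 3 := by positivity
  constructor <;> nlinarith

/-- Under the structural assumptions on `W = q qᵀ - Diag(q ∘ q) + N`,
the map `f(x) = (W x)^{∘1/3}` maps the box
`[½ (β q)^{∘1/3}, (3/2) (β q)^{∘1/3}]` (with `β = (qᵀ q^{∘1/3})^{3/2}`) into itself. -/
theorem stmt_3 (n : ℕ) (q : Fin n → ℝ) (hq : ∀ i, 0 < q i)
    (hqmax : ∀ i, q i ^ ((4 : ℝ) / 3) ≤ (∑ j, (q j ^ ((2 : ℝ) / 3)) ^ 2) / 45)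
    (N : Matrix (Fin n) (Fin n) ℝ) (hNsym : N.IsSymm) (hNdiag : ∀ i, N i i = 0)
    (hNrow : ∀ i, Real.sqrt (∑ j, (N i j) ^ 2) ≤
      q i * (∑ j, (q j ^ ((2 : ℝ) / 3)) ^ 2) /
        (45 * Real.sqrt (∑ j, (q j ^ ((1 : ℝ) / 3)) ^ 2)))
    (W : Matrix (Fin n) (Fin n) ℝ)
    (hW : W = Matrix.of (fun i j => q i * q j) - Matrix.diagonal (fun i => q i * q i) + N)
    (β : ℝ) (hβ : β = (∑ i, q i * q i ^ ((1 : ℝ) / 3)) ^ ((3 : ℝ) / 2))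
    (x : Fin n → ℝ)
    (hx : ∀ i, (1 / 2) * (β * q i) ^ ((1 : ℝ) / 3) ≤ x i ∧
               x i ≤ (3 / 2) * (β * q i) ^ ((1 : ℝ) / 3)) :
    ∀ i, (1 / 2) * (β * q i) ^ ((1 : ℝ) / 3) ≤ realCbrt (W.mulVec x i) ∧
         realCbrt (W.mulVec x i) ≤ (3 / 2) * (β * q i) ^ ((1 : ℝ) / 3) := by
  intro i
  set a : Fin n → ℝ := fun j => q j ^ ((1 : ℝ) / 3) with ha_def
  have ha : ∀ j, 0 < a j := fun j => Real.rpow_pos_of_pos (hq j) _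
  have hpow : ∀ j (k : ℕ), a j ^ k = q j ^ ((k : ℝ) / 3) := fun j k => by
    rw [ha_def, ← Real.rpow_natCast, ← Real.rpow_mul (hq j).le]
    congr 1
    ring
  have hqa : ∀ j, q j = a j ^ 3 := fun j => by
    rw [hpow]
    norm_num
  have hq2 : ∀ j, (q j ^ ((2 : ℝ) / 3)) ^ 2 = a j ^ 4 := fun j => by
    have h := hpow j 2
    push_cast at h
    rw [← h]
    ring
  have hS : 0 < ∑ j, a j ^ 4 :=
    Finset.sum_pos (fun j _ => pow_pos (ha j) 4) ⟨i, Finset.mem_univ i⟩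
  have hbS : √(∑ j, a j ^ 4) ^ 2 = ∑ j, a j ^ 4 := Real.sq_sqrt hS.le
  have hβS : β = (∑ j, a j ^ 4) ^ ((3 : ℝ) / 2) := by
    rw [hβ]
    congr 1
    refine Finset.sum_congr rfl fun j _ => ?_
    change q j * a j = _
    rw [hqa j]
    ring
  have hβq : ∀ j, (β * q j) ^ ((1 : ℝ) / 3) = √(∑ j, a j ^ 4) * a j := fun j => by
    rw [hβS, Real.mul_rpow (Real.rpow_nonneg hS.le _) (hq j).le, ← Real.rpow_mul hS.le,
      Real.sqrt_eq_rpow]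
    norm_num [ha_def]
  have hmax : a i ^ 4 ≤ √(∑ j, a j ^ 4) ^ 2 / 45 := by
    have h := hqmax i
    simp only [hq2] at h
    rw [hbS, hpow]
    exact_mod_cast h
  have hu := hNrow i
  simp only [hq2] at hu
  rw [← hbS, hqa i] at hu
  simp only [hβq] at hx ⊢
  have hWx : W.mulVec x i =
      a i ^ 3 * ∑ j, a j ^ 3 * x j - a i ^ 3 * a i ^ 3 * x i + ∑ j, N i j * x j := by
    rw [hW, Matrix.add_mulVec, Matrix.sub_mulVec, Pi.add_apply, Pi.sub_apply,
      Matrix.mulVec_diagonal, Finset.mul_sum]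
    simp only [Matrix.mulVec, dotProduct, Matrix.of_apply, ← hqa, mul_assoc]
  have hb := Real.sqrt_pos.2 hS
  have hc := mul_pos hb (ha i)
  obtain ⟨h₁, h₂⟩ := cube_bounds_of_mem_box a x ha hb hbS i hmax (N i) hu hx
  rw [hWx]
  exact le_realCbrt_and_le (by positivity) (by positivity) h₁ h₂
end

section
/- Let W = q qᵀ − Diag(q ∘ q) + N be a symmetric n×n matrix, where q ∈ ℝⁿ is an entrywise positive vector satisfying max_i q_i^{4/3} ≤ ‖q^{∘2/3}‖² / 45, and N is a symmetric n×n matrix with zero diagonal whose rows nⁱ satisfy ‖nⁱ‖ ≤ q_i ‖q^{∘2/3}‖² / (45 ‖q^{∘1/3}‖) for each i ∈ [n]. Set β = (qᵀ q^{∘1/3})^{3/2}. Then there exists a vector r in the box [½ (β q)^{∘1/3}, (3/2) (β q)^{∘1/3}] such that W r = r^{∘3}; in particular r is entrywise positive. -/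
open Filter Topology in
/-- A function `t ↦ t (d + t g(t))` that is nonpositive for small positive `t` has slope `d ≤ 0`. -/
theorem slope_nonpos_of_eventually_nonpos {d : ℝ} {g : ℝ → ℝ} (hg : Continuous g)
    (h : ∀ᶠ t in 𝓝[>] (0 : ℝ), t * (d + t * g t) ≤ 0) : d ≤ 0 := by
  have hlim : Tendsto (fun t => d + t * g t) (𝓝[>] (0 : ℝ)) (𝓝 d) := by
    have hc : Continuous fun t => d + t * g t := by fun_prop
    simpa using (hc.tendsto 0).mono_left nhdsWithin_le_nhds
  refine le_of_tendsto hlim ?_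
  filter_upwards [h, self_mem_nhdsWithin] with t ht hpos
  exact nonpos_of_mul_nonpos_right ht hpos

/-- The potential `½ rᵀ W r - ¼ ∑ rᵢ⁴`, whose gradient is `W r - r^{∘3}` for symmetric `W`. -/
noncomputable def quarticPotential {ι : Type*} [Fintype ι] (W : Matrix ι ι ℝ) (r : ι → ℝ) : ℝ :=
  (1 / 2) * (r ⬝ᵥ W.mulVec r) - (1 / 4) * ∑ i, r i ^ 4

theorem continuous_quarticPotential {ι : Type*} [Fintype ι] (W : Matrix ι ι ℝ) :
    Continuous (quarticPotential W) := by
  unfold quarticPotential dotProduct Matrix.mulVec dotProduct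
  fun_prop

theorem quarticPotential_add_single {ι : Type*} [Fintype ι] [DecidableEq ι] {W : Matrix ι ι ℝ}
    (hW : W.IsSymm) (r : ι → ℝ) (i : ι) (t : ℝ) :
    quarticPotential W (r + Pi.single i t) = quarticPotential W r +
      t * ((W.mulVec r i - r i ^ 3) + t * (W i i / 2 - 3 / 2 * r i ^ 2 - r i * t - t ^ 2 / 4)) := by
  have hsum : ∑ j, (r + Pi.single i t : ι → ℝ) j ^ 4 = ∑ j, r j ^ 4 + ((r i + t) ^ 4 - r i ^ 4) := by
    rw [← Finset.add_sum_erase _ _ (Finset.mem_univ i),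
      ← Finset.add_sum_erase _ (fun j => r j ^ 4) (Finset.mem_univ i)]
    have : ∑ j ∈ Finset.univ.erase i, (r + Pi.single i t : ι → ℝ) j ^ 4
        = ∑ j ∈ Finset.univ.erase i, r j ^ 4 :=
      Finset.sum_congr rfl fun j hj => by
        simp [Pi.single_eq_of_ne (Finset.ne_of_mem_erase hj)]
    rw [this]
    simp
    ring
  have hcross : r ⬝ᵥ W.mulVec (Pi.single i t) = t * W.mulVec r i := by
    rw [Matrix.dotProduct_mulVec, ← Matrix.mulVec_transpose, hW.eq, dotProduct_single, mul_comm]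
  have hdiag : W.mulVec (Pi.single i t) i = t * W i i := by
    simp [Matrix.mulVec, dotProduct_single, mul_comm]
  unfold quarticPotential
  rw [hsum, Matrix.mulVec_add, dotProduct_add, add_dotProduct, add_dotProduct, hcross,
    single_dotProduct, single_dotProduct, hdiag]
  ring

open Filter Topology in
/-- If `r ↦ (W r)^{∘1/3}` maps a box into itself and `W` is symmetric, then it has a fixed point
there: a maximizer over the box of the potential `½ rᵀ W r - ¼ ∑ rᵢ⁴`. -/
theorem exists_mulVec_eq_cube_of_mapsTo_box {ι : Type*} [Fintype ι] {W : Matrix ι ι ℝ}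
    (hW : W.IsSymm) {l u : ι → ℝ} (hlu : l ≤ u)
    (hmap : ∀ r ∈ Set.Icc l u, ∀ i, l i ^ 3 ≤ W.mulVec r i ∧ W.mulVec r i ≤ u i ^ 3) :
    ∃ r ∈ Set.Icc l u, W.mulVec r = fun i => r i ^ 3 := by
  classical
  obtain ⟨r, hr, hmax⟩ := isCompact_Icc.exists_isMaxOn (Set.nonempty_Icc.2 hlu)
    (continuous_quarticPotential W).continuousOn
  have hstep : ∀ i t, l i ≤ r i + t → r i + t ≤ u i →
      t * ((W.mulVec r i - r i ^ 3) +
        t * (W i i / 2 - 3 / 2 * r i ^ 2 - r i * t - t ^ 2 / 4)) ≤ 0 := by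
    intro i t hl hu
    have hmem : r + Pi.single i t ∈ Set.Icc l u := by
      constructor <;> intro j <;> by_cases hj : j = i
      · subst hj; simpa using hl
      · simpa [Pi.single_eq_of_ne hj] using hr.1 j
      · subst hj; simpa using hu
      · simpa [Pi.single_eq_of_ne hj] using hr.2 j
    have h : quarticPotential W (r + Pi.single i t) ≤ quarticPotential W r := hmax hmem
    rw [quarticPotential_add_single hW] at h
    linarith
  have hsmall : ∀ {ε : ℝ}, 0 < ε → ∀ᶠ t in 𝓝[>] (0 : ℝ), t ∈ Set.Ioo 0 ε :=
    fun hε => Ioo_mem_nhdsGT hε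
  refine ⟨r, hr, funext fun i => le_antisymm ?_ ?_⟩
  · rcases (hr.2 i).eq_or_lt with h | h
    · rw [h]; exact (hmap r hr i).2
    · refine sub_nonpos.1 (slope_nonpos_of_eventually_nonpos
        (g := fun t => W i i / 2 - 3 / 2 * r i ^ 2 - r i * t - t ^ 2 / 4) (by fun_prop) ?_)
      filter_upwards [hsmall (sub_pos.2 h)] with t ht
      exact hstep i t (by linarith [hr.1 i, ht.1]) (by linarith [ht.2])
  · rcases (hr.1 i).eq_or_lt with h | h
    · rw [← h]; exact (hmap r hr i).1
    · refine sub_nonpos.1 (slope_nonpos_of_eventually_nonpos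
        (g := fun t => W i i / 2 - 3 / 2 * r i ^ 2 + r i * t - t ^ 2 / 4) (by fun_prop) ?_)
      filter_upwards [hsmall (sub_pos.2 h)] with t ht
      have := hstep i (-t) (by linarith [ht.2]) (by linarith [hr.2 i, ht.1])
      linarith

/-- With `q = c^{∘3}` and `s² = ∑ cⱼ⁴`, the map `r ↦ (W r)^{∘1/3}` sends the box
`[½ s c, (3/2) s c]` into itself. -/
theorem mulVec_mem_cube_box {ι : Type*} [Fintype ι] [DecidableEq ι] {c : ι → ℝ} {s : ℝ}
    (hc : ∀ i, 0 < c i) (hs : 0 ≤ s) (hsq : s ^ 2 = ∑ j, c j ^ 4)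
    (hmax : ∀ i, c i ^ 4 ≤ s ^ 2 / 45) {N : Matrix ι ι ℝ}
    (hN : ∀ i, √(∑ j, N i j ^ 2) ≤ c i ^ 3 * s ^ 2 / (45 * √(∑ j, c j ^ 2)))
    {r : ι → ℝ} (hl : ∀ i, 1 / 2 * (s * c i) ≤ r i) (hu : ∀ i, r i ≤ 3 / 2 * (s * c i)) (i : ι) :
    let W := Matrix.of (fun i j => c i ^ 3 * c j ^ 3)
      - Matrix.diagonal (fun i => c i ^ 3 * c i ^ 3) + N
    (1 / 2 * (s * c i)) ^ 3 ≤ W.mulVec r i ∧ W.mulVec r i ≤ (3 / 2 * (s * c i)) ^ 3 := by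
  intro W
  have hW : W.mulVec r i = c i ^ 3 * ∑ j, c j ^ 3 * r j - c i ^ 6 * r i + ∑ j, N i j * r j := by
    simp only [W, Matrix.add_mulVec, Matrix.sub_mulVec, Pi.add_apply, Pi.sub_apply,
      Matrix.mulVec_diagonal]
    simp only [Matrix.mulVec, dotProduct, Matrix.of_apply, Finset.mul_sum, mul_assoc]
    ring
  have hr0 : ∀ j, 0 ≤ r j := fun j => le_trans (by have := hc j; positivity) (hl j)
  have hlow : 1 / 2 * s ^ 3 ≤ ∑ j, c j ^ 3 * r j := by
    calc 1 / 2 * s ^ 3 = ∑ j, c j ^ 3 * (1 / 2 * (s * c j)) := by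
          rw [pow_succ, hsq, Finset.sum_mul, Finset.mul_sum]
          exact Finset.sum_congr rfl fun j _ => by ring
      _ ≤ _ := Finset.sum_le_sum fun j _ =>
          mul_le_mul_of_nonneg_left (hl j) (pow_nonneg (hc j).le 3)
  have hupp : ∑ j, c j ^ 3 * r j ≤ 3 / 2 * s ^ 3 := by
    calc _ ≤ ∑ j, c j ^ 3 * (3 / 2 * (s * c j)) := Finset.sum_le_sum fun j _ =>
          mul_le_mul_of_nonneg_left (hu j) (pow_nonneg (hc j).le 3)
      _ = 3 / 2 * s ^ 3 := by
          rw [pow_succ, hsq, Finset.sum_mul, Finset.mul_sum]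
          exact Finset.sum_congr rfl fun j _ => by ring
  have hdiag : c i ^ 6 * r i ≤ c i ^ 3 * s ^ 3 / 30 := by
    calc c i ^ 6 * r i ≤ c i ^ 6 * (3 / 2 * (s * c i)) :=
          mul_le_mul_of_nonneg_left (hu i) (pow_nonneg (hc i).le 6)
      _ = c i ^ 3 * s * (3 / 2) * c i ^ 4 := by ring
      _ ≤ c i ^ 3 * s * (3 / 2) * (s ^ 2 / 45) :=
          mul_le_mul_of_nonneg_left (hmax i) (by have := hc i; positivity)
      _ = _ := by ring
  have hnorm : √(∑ j, r j ^ 2) ≤ 3 / 2 * s * √(∑ j, c j ^ 2) := by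
    refine Real.sqrt_le_iff.2 ⟨by positivity, ?_⟩
    rw [mul_pow, Real.sq_sqrt (Finset.sum_nonneg fun j _ => sq_nonneg _), Finset.mul_sum]
    refine Finset.sum_le_sum fun j _ => ?_
    calc r j ^ 2 ≤ (3 / 2 * (s * c j)) ^ 2 := pow_le_pow_left₀ (hr0 j) (hu j) 2
      _ = _ := by ring
  have hcpos : 0 < √(∑ j, c j ^ 2) :=
    Real.sqrt_pos.2 (Finset.sum_pos (fun j _ => pow_pos (hc j) 2) ⟨i, Finset.mem_univ i⟩)
  have hnoise : |∑ j, N i j * r j| ≤ c i ^ 3 * s ^ 3 / 30 := by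
    calc |∑ j, N i j * r j| ≤ √(∑ j, N i j ^ 2) * √(∑ j, r j ^ 2) := by
          rw [← Real.sqrt_mul (Finset.sum_nonneg fun j _ => sq_nonneg _)]
          exact Real.abs_le_sqrt (Finset.sum_mul_sq_le_sq_mul_sq _ _ _)
      _ ≤ c i ^ 3 * s ^ 2 / (45 * √(∑ j, c j ^ 2)) * (3 / 2 * s * √(∑ j, c j ^ 2)) := by
          have := hc i
          exact mul_le_mul (hN i) hnorm (Real.sqrt_nonneg _) (by positivity)
      _ = _ := by field_simp; ring
  have hpos : 0 ≤ c i ^ 3 * s ^ 3 := by have := hc i; positivity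
  have hdiag0 : 0 ≤ c i ^ 6 * r i := mul_nonneg (pow_nonneg (hc i).le 6) (hr0 i)
  have hlow' := mul_le_mul_of_nonneg_left hlow (pow_nonneg (hc i).le 3)
  have hupp' := mul_le_mul_of_nonneg_left hupp (pow_nonneg (hc i).le 3)
  have hnoise' := abs_le.1 hnoise
  rw [hW]
  constructor <;> nlinarith


/-- Under the structural assumptions on `W = q qᵀ - Diag(q ∘ q) + N`,
there exists a vector `r` in the box `[½ (β q)^{∘1/3}, (3/2) (β q)^{∘1/3}]`
(with `β = (qᵀ q^{∘1/3})^{3/2}`) such that `W r = r^{∘3}`; in particular `r` is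
entrywise positive. -/
theorem stmt_4 (n : ℕ) (q : Fin n → ℝ) (hq : ∀ i, 0 < q i)
    (hqmax : ∀ i, q i ^ ((4 : ℝ) / 3) ≤ (∑ j, (q j ^ ((2 : ℝ) / 3)) ^ 2) / 45)
    (N : Matrix (Fin n) (Fin n) ℝ) (hNsym : N.IsSymm) (hNdiag : ∀ i, N i i = 0)
    (hNrow : ∀ i, Real.sqrt (∑ j, (N i j) ^ 2) ≤
      q i * (∑ j, (q j ^ ((2 : ℝ) / 3)) ^ 2) /
        (45 * Real.sqrt (∑ j, (q j ^ ((1 : ℝ) / 3)) ^ 2)))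
    (W : Matrix (Fin n) (Fin n) ℝ)
    (hW : W = Matrix.of (fun i j => q i * q j) - Matrix.diagonal (fun i => q i * q i) + N)
    (β : ℝ) (hβ : β = (∑ i, q i * q i ^ ((1 : ℝ) / 3)) ^ ((3 : ℝ) / 2)) :
    ∃ r : Fin n → ℝ,
      (∀ i, (1 / 2) * (β * q i) ^ ((1 : ℝ) / 3) ≤ r i ∧
            r i ≤ (3 / 2) * (β * q i) ^ ((1 : ℝ) / 3)) ∧
      W.mulVec r = (fun i => (r i) ^ 3) ∧
      (∀ i, 0 < r i) := by
  obtain ⟨c, hc, rfl⟩ : ∃ c : Fin n → ℝ, (∀ i, 0 < c i) ∧ q = fun i => c i ^ 3 :=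
    ⟨fun i => q i ^ ((1 : ℝ) / 3), fun i => Real.rpow_pos_of_pos (hq i) _, funext fun i => by
      rw [← Real.rpow_natCast, ← Real.rpow_mul (hq i).le]; norm_num⟩
  have hroot : ∀ x : ℝ, 0 ≤ x → (x ^ 3) ^ ((1 : ℝ) / 3) = x := fun x hx => by
    rw [← Real.rpow_natCast, ← Real.rpow_mul hx]; norm_num
  have hroot2 : ∀ i, (c i ^ 3) ^ ((2 : ℝ) / 3) = c i ^ 2 := fun i => by
    rw [← Real.rpow_natCast, ← Real.rpow_mul (hc i).le, ← Real.rpow_natCast]; norm_num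
  have hroot4 : ∀ i, (c i ^ 3) ^ ((4 : ℝ) / 3) = c i ^ 4 := fun i => by
    rw [← Real.rpow_natCast, ← Real.rpow_mul (hc i).le, ← Real.rpow_natCast]; norm_num
  have hS : 0 ≤ ∑ j, c j ^ 4 := Finset.sum_nonneg fun j _ => pow_nonneg (hc j).le 4
  set s := √(∑ j, c j ^ 4) with hs_def
  have hs : 0 ≤ s := Real.sqrt_nonneg _
  have hsq : s ^ 2 = ∑ j, c j ^ 4 := Real.sq_sqrt hS
  have hsum : ∑ j, (c j ^ 2) ^ 2 = s ^ 2 := by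
    rw [hsq]; exact Finset.sum_congr rfl fun j _ => by ring
  have hβs : β = s ^ 3 := by
    have h : ∑ i, c i ^ 3 * (c i ^ 3) ^ ((1 : ℝ) / 3) = s ^ 2 := by
      rw [hsq]
      exact Finset.sum_congr rfl fun j _ => by rw [hroot _ (hc j).le]; ring
    rw [hβ, h, ← Real.rpow_natCast, ← Real.rpow_mul hs, ← Real.rpow_natCast]
    norm_num
  have hscale : ∀ i, (β * c i ^ 3) ^ ((1 : ℝ) / 3) = s * c i := fun i => by
    rw [hβs, ← mul_pow, hroot _ (mul_nonneg hs (hc i).le)]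
  simp only [hroot2, hroot4, hsum] at hqmax hNrow
  simp only [hroot _ (hc _).le] at hNrow
  have hWsymm : W.IsSymm := by
    rw [hW]
    refine Matrix.IsSymm.add (Matrix.IsSymm.sub ?_ (Matrix.isSymm_diagonal _)) hNsym
    exact Matrix.IsSymm.ext fun i j => mul_comm _ _
  obtain ⟨r, hr, hWr⟩ := exists_mulVec_eq_cube_of_mapsTo_box hWsymm
    (l := fun i => 1 / 2 * (s * c i)) (u := fun i => 3 / 2 * (s * c i))
    (fun i => by have := mul_nonneg hs (hc i).le; dsimp only; linarith)
    (fun r hr i => by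
      rw [hW]; exact mulVec_mem_cube_box hc hs hsq hqmax hNrow hr.1 hr.2 i)
  refine ⟨r, fun i => ?_, hWr, fun i => ?_⟩
  · rw [hscale]; exact ⟨hr.1 i, hr.2 i⟩
  · have hspos : 0 < s := Real.sqrt_pos.2
      (Finset.sum_pos (fun j _ => pow_pos (hc j) 4) ⟨i, Finset.mem_univ i⟩)
    have := mul_pos hspos (hc i)
    exact lt_of_lt_of_le (by positivity) (hr.1 i)
end

section
/- Let w ∈ ℝ and let a_1, ..., a_m, b_1, ..., b_m be positive reals. Consider the signed graph on m + 2 nodes {1, 2, 3, ..., m+2} with edge weights w on edge {1,2}, a_l on edge {1, l+2}, and b_l on edge {2, l+2} for each l ∈ [m], and no other edges. Then the Laplacian of this graph is positive semidefinite if and only if −w ≤ Σ_{l=1}^{m} a_l b_l / (a_l + b_l). -/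
/-- Weighted adjacency matrix of the graph on `m + 2` nodes consisting of the edge
`{1,2}` with weight `w` and, for each `l`, the two-edge path `1 — l — 2` with
weights `a l` and `b l`. Node `1` is `Sum.inl ()`, node `2` is `Sum.inr (Sum.inl ())`,
and the `m` intermediate nodes are `Sum.inr (Sum.inr l)`. -/
def twoEdgePathsW (m : ℕ) (w : ℝ) (a b : Fin m → ℝ) :
    Matrix (Unit ⊕ Unit ⊕ Fin m) (Unit ⊕ Unit ⊕ Fin m) ℝ := fun x y =>
  match x, y with
  | Sum.inl _, Sum.inr (Sum.inl _) => w
  | Sum.inr (Sum.inl _), Sum.inl _ => w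
  | Sum.inl _, Sum.inr (Sum.inr l) => a l
  | Sum.inr (Sum.inr l), Sum.inl _ => a l
  | Sum.inr (Sum.inl _), Sum.inr (Sum.inr l) => b l
  | Sum.inr (Sum.inr l), Sum.inr (Sum.inl _) => b l
  | _, _ => 0

lemma twoEdgePathsW_isHermitian_laplacian (m : ℕ) (w : ℝ) (a b : Fin m → ℝ) :
    (Matrix.diagonal (fun i => ∑ j, twoEdgePathsW m w a b i j)
        - twoEdgePathsW m w a b).IsHermitian := by
  refine (Matrix.isHermitian_diagonal _).sub ?_
  ext (_ | _ | _) (_ | _ | _) <;> simp [twoEdgePathsW]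

/-- The Laplacian quadratic form as a sum over edges. -/
lemma twoEdgePathsW_laplacian_quadraticForm (m : ℕ) (w : ℝ) (a b : Fin m → ℝ)
    (x : Unit ⊕ Unit ⊕ Fin m → ℝ) :
    x ⬝ᵥ (Matrix.diagonal (fun i => ∑ j, twoEdgePathsW m w a b i j)
        - twoEdgePathsW m w a b).mulVec x =
      w * (x (Sum.inl ()) - x (Sum.inr (Sum.inl ()))) ^ 2 +
        ∑ l, (a l * (x (Sum.inl ()) - x (Sum.inr (Sum.inr l))) ^ 2 +
          b l * (x (Sum.inr (Sum.inl ())) - x (Sum.inr (Sum.inr l))) ^ 2) := by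
  rw [Matrix.sub_mulVec, dotProduct_sub]
  simp only [Matrix.mulVec_diagonal, dotProduct]
  simp only [Matrix.mulVec, dotProduct, Fintype.sum_sum_type,
    twoEdgePathsW, Finset.univ_unique, Finset.sum_singleton, PUnit.default_eq_unit,
    Finset.sum_const_zero, zero_mul, zero_add, add_zero]
  have expand : ∀ l, a l * (x (Sum.inl ()) - x (Sum.inr (Sum.inr l))) ^ 2 +
      b l * (x (Sum.inr (Sum.inl ())) - x (Sum.inr (Sum.inr l))) ^ 2 =
      a l * x (Sum.inl ()) ^ 2 + b l * x (Sum.inr (Sum.inl ())) ^ 2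
      + x (Sum.inr (Sum.inr l)) * ((a l + b l) * x (Sum.inr (Sum.inr l)))
      - x (Sum.inl ()) * (a l * x (Sum.inr (Sum.inr l)))
      - x (Sum.inr (Sum.inl ())) * (b l * x (Sum.inr (Sum.inr l)))
      - x (Sum.inr (Sum.inr l)) *
        (a l * x (Sum.inl ()) + b l * x (Sum.inr (Sum.inl ()))) := fun l => by ring
  simp only [expand, Finset.sum_add_distrib, Finset.sum_sub_distrib, ← Finset.sum_mul,
    ← Finset.mul_sum]
  ring

/-- The two-edge path from `p` to `q` through `z` has effective conductance
`a * b / (a + b)`. -/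
lemma weighted_sq_add_weighted_sq {a b : ℝ} (h : a + b ≠ 0) (p q z : ℝ) :
    a * (p - z) ^ 2 + b * (q - z) ^ 2 =
      a * b / (a + b) * (p - q) ^ 2 + (a + b) * (z - (a * p + b * q) / (a + b)) ^ 2 := by
  field_simp
  ring

/-- For the signed graph consisting of the edge `{1,2}` with weight `w`
and `m` disjoint two-edge paths `1 — (l+2) — 2` with positive weights `a l`, `b l`,
the Laplacian is positive semidefinite iff `-w ≤ ∑ l, a l * b l / (a l + b l)`. -/
theorem stmt_8 (m : ℕ) (w : ℝ) (a b : Fin m → ℝ)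
    (ha : ∀ l, 0 < a l) (hb : ∀ l, 0 < b l) :
    (Matrix.diagonal (fun i => ∑ j, twoEdgePathsW m w a b i j)
        - twoEdgePathsW m w a b).PosSemidef ↔
      -w ≤ ∑ l, a l * b l / (a l + b l) := by
  have hab : ∀ l, a l + b l ≠ 0 := fun l => (add_pos (ha l) (hb l)).ne'
  have form (x : Unit ⊕ Unit ⊕ Fin m → ℝ) :=
    twoEdgePathsW_laplacian_quadraticForm m w a b x
  simp only [fun l => weighted_sq_add_weighted_sq (hab l), Finset.sum_add_distrib,
    ← Finset.sum_mul, ← add_assoc, ← add_mul] at form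
  constructor
  · intro h
    have hx := h.dotProduct_mulVec_nonneg
      (Sum.elim (fun _ => 1) (Sum.elim (fun _ => 0) fun l => a l / (a l + b l)))
    rw [star_trivial, form] at hx
    simp at hx
    linarith
  · intro h
    refine .of_dotProduct_mulVec_nonneg (twoEdgePathsW_isHermitian_laplacian m w a b) fun x => ?_
    rw [star_trivial, form]
    exact add_nonneg (mul_nonneg (by linarith) (sq_nonneg _))
      (Finset.sum_nonneg fun l _ => mul_nonneg (add_pos (ha l) (hb l)).le (sq_nonneg _))
end
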